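/- If (f_t)_{t≥0} is a family of univalent holomorphic self-maps of ℍ with f_0 = id and f_t(ℍ) ⊆ f_s(ℍ) for 0 ≤ s ≤ t, and each f_t is the F-transform of a probability measure μ_{0,t}, then for each 0 ≤ s ≤ t the transition map f_{s,t} := f_s^{−1} ∘ f_t is a well-defined holomorphic self-map of ℍ which is the F-transform of a probability measure μ_{s,t}, and μ_{0,t} = μ_{0,s} ▷ μ_{s,t}, i.e., F_{μ_{0,t}} = F_{μ_{0,s}} ∘ F_{μ_{s,t}}. -/

import Mathlib

open MeasureTheory Complex

section

open Filter Topology Set Metric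

/-- The inverse of an injective holomorphic function on an open set is holomorphic on the image. -/
theorem differentiableAt_invFunOn_of_injOn {f : ℂ → ℂ} {U : Set ℂ} (hU : IsOpen U)
    (hf : DifferentiableOn ℂ f U) (hinj : InjOn f U) {z₀ : ℂ} (hz₀ : z₀ ∈ U) :
    DifferentiableAt ℂ (Function.invFunOn f U) (f z₀) := by
  set h := Function.invFunOn f U
  have hleft : ∀ z ∈ U, h (f z) = z := fun z hz => hinj.leftInvOn_invFunOn hz
  have hconst : ∀ z ∈ U, ∀ c, ¬ ∀ᶠ w in 𝓝 z, f w = c := by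
    intro z hz c hc
    have h1 : ∀ᶠ w in 𝓝 z, w ∈ ({z} : Set ℂ) := by
      filter_upwards [hc, hU.mem_nhds hz] with w hw hwU
      exact hinj hwU hz (hw.trans hc.self_of_nhds.symm)
    exact (NeBot.ne (inferInstance : NeBot (𝓝[≠] z)))
      (by rw [nhdsWithin, inf_principal_eq_bot, compl_compl]; exact h1)
  have hopen : ∀ z ∈ U, 𝓝 (f z) ≤ map f (𝓝 z) := fun z hz =>
    ((hf.analyticAt (hU.mem_nhds hz)).eventually_constant_or_nhds_le_map_nhds).resolve_left
      (hconst z hz _)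
  have hcont : ∀ z ∈ U, Tendsto h (𝓝 (f z)) (𝓝 z) := by
    intro z hz
    refine (tendsto_map'_iff.2 ?_).mono_left (hopen z hz)
    refine tendsto_id.congr' ?_
    filter_upwards [hU.mem_nhds hz] with w hw using (hleft w hw).symm
  have hright : ∀ z ∈ U, ∀ᶠ w in 𝓝 (f z), ∃ x ∈ U, f x = w := fun z hz =>
    hopen z hz <| mem_map.2 <| by
      filter_upwards [hU.mem_nhds hz] with x hx using ⟨x, hx, rfl⟩
  have hderiv : ∀ᶠ z in 𝓝[≠] z₀, deriv f z ≠ 0 := by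
    refine ((hf.analyticAt (hU.mem_nhds hz₀)).deriv.eventually_eq_zero_or_eventually_ne_zero
      ).resolve_left fun h0 => ?_
    obtain ⟨r, hr, hrs⟩ := Metric.eventually_nhds_iff_ball.1 (h0.and (hU.mem_nhds hz₀))
    refine hconst z₀ hz₀ (f z₀) (Metric.eventually_nhds_iff_ball.2 ⟨r, hr, fun w hw => ?_⟩)
    exact isOpen_ball.is_const_of_deriv_eq_zero (convex_ball z₀ r).isPreconnected
      (hf.mono fun x hx => (hrs x hx).2) (fun x hx => (hrs x hx).1) hw (mem_ball_self hr)
  refine (analyticAt_of_differentiable_on_punctured_nhds_of_continuousAt ?_ ?_).differentiableAt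
  · have ht : Tendsto h (𝓝[≠] f z₀) (𝓝[≠] z₀) := by
      refine tendsto_nhdsWithin_iff.2 ⟨(hcont z₀ hz₀).mono_left nhdsWithin_le_nhds, ?_⟩
      filter_upwards [nhdsWithin_le_nhds (hright z₀ hz₀), self_mem_nhdsWithin]
      rintro _ ⟨x, hx, rfl⟩ hne
      rw [mem_compl_singleton_iff, hleft x hx]
      rintro rfl
      exact hne rfl
    filter_upwards [ht.eventually hderiv, nhdsWithin_le_nhds (hright z₀ hz₀)]
    rintro _ hd ⟨x, hx, rfl⟩
    rw [hleft x hx] at hd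
    have hfx := (hf.differentiableAt (hU.mem_nhds hx)).hasDerivAt
    refine (HasDerivAt.of_local_left_inverse (f := f) (f' := deriv f x)
      ?_ ?_ hd ?_).differentiableAt
    · simpa [ContinuousAt, hleft x hx] using hcont x hx
    · rwa [hleft x hx]
    · filter_upwards [hright x hx]
      rintro _ ⟨y, hy, rfl⟩
      rw [hleft y hy]
  · simpa [ContinuousAt, hleft z₀ hz₀] using hcont z₀ hz₀

theorem continuous_poissonKernel_circleMap {w : ℂ} (hw : w ∈ ball (0 : ℂ) 1) :
    Continuous fun θ => poissonKernel 0 w (circleMap 0 1 θ) := by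
  simp only [poissonKernel_def, sub_zero]
  refine Continuous.div (by fun_prop) (by fun_prop) fun θ => ?_
  have := sub_ne_zero.2 (circleMap_ne_mem_ball hw θ)
  positivity

theorem exists_norm_poissonKernel_circleMap_le {w : ℂ} (hw : w ∈ ball (0 : ℂ) 1) :
    ∃ C, ∀ θ, ‖poissonKernel 0 w (circleMap 0 1 θ)‖ ≤ C := by
  have hper : Function.Periodic (fun θ => poissonKernel 0 w (circleMap 0 1 θ)) (2 * Real.pi) :=
    fun θ => by simp only [periodic_circleMap 0 1 θ]
  obtain ⟨C, hC⟩ := isBounded_iff_forall_norm_le.1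
    (hper.isBounded_of_continuous Real.two_pi_pos.ne' (continuous_poissonKernel_circleMap hw))
  exact ⟨C, fun θ => hC _ ⟨θ, rfl⟩⟩

/-- **Herglotz representation** of the real part of a holomorphic function on the unit disc with
nonnegative real part, with the unit circle parametrised by angle. -/
theorem exists_measure_re_eq_integral_poissonKernel {p : ℂ → ℂ}
    (hp : DifferentiableOn ℂ p (ball 0 1)) (hpos : ∀ w ∈ ball (0 : ℂ) 1, 0 ≤ (p w).re) :
    ∃ σ : Measure ℝ, IsFiniteMeasure σ ∧ ∀ w ∈ ball (0 : ℂ) 1,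
      (p w).re = ∫ θ, poissonKernel 0 w (circleMap 0 1 θ) ∂σ := by
  set r : ℕ → ℝ := fun n => 1 - 1 / ((n : ℝ) + 1) with hr
  have hr0 : ∀ n, 0 ≤ r n := fun n => by
    simp only [hr, sub_nonneg]
    rw [div_le_one (by positivity)]
    linarith [n.cast_nonneg (α := ℝ)]
  have hr1 : ∀ n, r n < 1 := fun n => by
    simp only [hr, sub_lt_self_iff]
    positivity
  have hrt : Tendsto r atTop (𝓝 1) := by
    simpa [hr] using (tendsto_one_div_add_atTop_nhds_zero_nat (𝕜 := ℝ)).const_sub 1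
  have hmem : ∀ n, ∀ z ∈ closedBall (0 : ℂ) 1, (r n : ℂ) * z ∈ ball (0 : ℂ) 1 := by
    intro n z hz
    rw [mem_closedBall_zero_iff] at hz
    rw [mem_ball_zero_iff, norm_mul, Complex.norm_real, Real.norm_of_nonneg (hr0 n)]
    nlinarith [hr0 n, hr1 n, norm_nonneg z]
  set u : ℕ → ℝ → ℝ := fun n θ => (2 * Real.pi)⁻¹ * (p (r n * circleMap 0 1 θ)).re with hu
  have hcm : ∀ n θ, (r n : ℂ) * circleMap 0 1 θ ∈ ball (0 : ℂ) 1 := fun n θ =>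
    hmem n _ (by simp)
  have huc : ∀ n, Continuous (u n) := by
    intro n
    refine continuous_const.mul (Complex.continuous_re.comp ?_)
    exact hp.continuousOn.comp_continuous (by fun_prop) (hcm n)
  have hu0 : ∀ n θ, 0 ≤ u n θ := fun n θ => mul_nonneg (by positivity) (hpos _ (hcm n θ))
  set σ : ℕ → Measure ℝ := fun n =>
    (volume.restrict (Ioc 0 (2 * Real.pi))).withDensity fun θ => ENNReal.ofReal (u n θ) with hσ
  have hui : ∀ n, Integrable (u n) (volume.restrict (Ioc 0 (2 * Real.pi))) := fun n =>
    ((huc n).integrableOn_Icc (a := 0) (b := 2 * Real.pi)).mono_set Ioc_subset_Icc_self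
  have hfin : ∀ n, IsFiniteMeasure (σ n) := fun n =>
    isFiniteMeasure_withDensity_ofReal (hui n).2
  have hformula : ∀ n, ∀ w ∈ ball (0 : ℂ) 1,
      ∫ θ, poissonKernel 0 w (circleMap 0 1 θ) ∂(σ n) = (p (r n * w)).re := by
    intro n w hw
    have hd : DiffContOnCl ℂ (fun z => p (r n * z)) (ball 0 1) := by
      refine DifferentiableOn.diffContOnCl ?_
      rw [closure_ball _ one_ne_zero]
      exact hp.comp (by fun_prop) (hmem n)
    have h1 := hd.circleAverage_poissonKernel_smul hw
    rw [Real.circleAverage_def, intervalIntegral.integral_of_le (by positivity)] at h1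
    have h2 := congrArg Complex.re h1
    rw [Complex.smul_re, ← Complex.reCLM_apply, ← ContinuousLinearMap.integral_comp_comm] at h2
    · rw [← h2, hσ]
      simp only
      rw [integral_withDensity_eq_integral_toReal_smul (by fun_prop) (by simp)]
      rw [← integral_smul]
      refine integral_congr_ae (.of_forall fun θ => ?_)
      simp only [ENNReal.toReal_ofReal (hu0 n θ)]
      simp only [hu, smul_eq_mul, Pi.smul_apply', reCLM_apply, Complex.smul_re]
      ring
    · refine Continuous.integrableOn_Ioc ?_
      exact (continuous_poissonKernel_circleMap hw).smul
        (hp.continuousOn.comp_continuous (by fun_prop) (hcm n))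
  set S : ℕ → FiniteMeasure ℝ := fun n => ⟨σ n, hfin n⟩ with hS
  have hmass : ∀ n, ((S n).mass : ℝ) = (p 0).re := by
    intro n
    have := hformula n 0 (by simp)
    simp only [poissonKernel_def, sub_zero, norm_circleMap_zero] at this
    simpa [hS, FiniteMeasure.mass, Measure.real, ENNReal.toReal] using this
  have hK := isCompact_setOfPred_finiteMeasure_le_of_isCompact (E := ℝ) ((p 0).re.toNNReal)
    (isCompact_Icc (a := (0 : ℝ)) (b := 2 * Real.pi))
  have hSK : ∀ n, S n ∈ {μ : FiniteMeasure ℝ | μ.mass ≤ (p 0).re.toNNReal ∧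
      μ (Icc 0 (2 * Real.pi))ᶜ = 0} := by
    intro n
    refine ⟨?_, ?_⟩
    · rw [← hmass n, Real.toNNReal_coe]
    · have : σ n (Icc 0 (2 * Real.pi))ᶜ = 0 := by
        refine withDensity_absolutelyContinuous _ _ ?_
        rw [Measure.restrict_apply measurableSet_Icc.compl]
        convert measure_empty (μ := (volume : Measure ℝ))
        ext x
        simp +contextual [le_of_lt]
      simp [hS, this]
  obtain ⟨ρ, -, hρ⟩ := hK.ultrafilter_le_nhds' ((hyperfilter ℕ).map S)
    (Filter.Eventually.of_forall (f := (hyperfilter ℕ : Filter ℕ)) hSK)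
  refine ⟨ρ, inferInstance, fun w hw => ?_⟩
  obtain ⟨C, hC⟩ := exists_norm_poissonKernel_circleMap_le hw
  let k : BoundedContinuousFunction ℝ ℝ := BoundedContinuousFunction.ofNormedAddCommGroup
    (fun θ => poissonKernel 0 w (circleMap 0 1 θ)) (continuous_poissonKernel_circleMap hw) C hC
  have hSt : Tendsto S (hyperfilter ℕ) (𝓝 ρ) := hρ
  have ht1 := (FiniteMeasure.tendsto_iff_forall_integral_tendsto.1 hSt) k
  have ht2 : Tendsto (fun n => ∫ θ, k θ ∂(S n : Measure ℝ)) (hyperfilter ℕ) (𝓝 (p w).re) := by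
    have heq : (fun n => ∫ θ, k θ ∂(S n : Measure ℝ)) = fun n => (p (r n * w)).re :=
      funext fun n => hformula n w hw
    rw [heq]
    refine Tendsto.mono_left ?_ (Nat.hyperfilter_le_atTop)
    have hpw := (hp.continuousOn.continuousAt (isOpen_ball.mem_nhds hw))
    refine (Complex.continuous_re.continuousAt.comp hpw).tendsto.comp ?_
    simpa using ((Complex.continuous_ofReal.tendsto 1).comp hrt).mul_const w
  exact tendsto_nhds_unique ht2 ht1

theorem isOpen_setOf_im_pos : IsOpen {z : ℂ | 0 < z.im} :=
  isOpen_lt continuous_const Complex.continuous_im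

theorem im_le_norm_sub_ofReal (z : ℂ) (x : ℝ) : z.im ≤ ‖z - x‖ := by
  simpa using Complex.im_le_norm (z - x)

theorem sub_ofReal_ne_zero {z : ℂ} (hz : 0 < z.im) (x : ℝ) : z - x ≠ 0 :=
  norm_pos_iff.1 (hz.trans_le (im_le_norm_sub_ofReal z x))

theorem integrable_inv_sub_ofReal (ν : Measure ℝ) [IsFiniteMeasure ν] {z : ℂ} (hz : 0 < z.im) :
    Integrable (fun x : ℝ => (z - x)⁻¹) ν := by
  refine Integrable.of_bound (by fun_prop) z.im⁻¹ (.of_forall fun x => ?_)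
  rw [norm_inv]
  exact inv_anti₀ hz (im_le_norm_sub_ofReal z x)

/-- The Cauchy transform of a finite measure is holomorphic on the upper half-plane. -/
theorem differentiableOn_integral_inv_sub (ν : Measure ℝ) [IsFiniteMeasure ν] :
    DifferentiableOn ℂ (fun z : ℂ => ∫ x : ℝ, (z - x)⁻¹ ∂ν) {z : ℂ | 0 < z.im} := by
  intro z₀ (hz₀ : 0 < z₀.im)
  have hs : {z : ℂ | z₀.im / 2 < z.im} ∈ 𝓝 z₀ :=
    (isOpen_lt continuous_const Complex.continuous_im).mem_nhds (half_lt_self hz₀)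
  refine (hasDerivAt_integral_of_dominated_loc_of_deriv_le
    (μ := ν) (F := fun (z : ℂ) (x : ℝ) => (z - x)⁻¹)
    (F' := fun (z : ℂ) (x : ℝ) => -1 / (z - x) ^ 2) (bound := fun _ => ((z₀.im / 2) ^ 2)⁻¹) hs
    (.of_forall fun z => by fun_prop) (integrable_inv_sub_ofReal ν hz₀)
    (Measurable.aestronglyMeasurable (by fun_prop))
    (.of_forall fun x z hz => ?_) (integrable_const _)
    (.of_forall fun x z hz => ?_)).2.differentiableAt.differentiableWithinAt
  · rw [norm_div, norm_neg, norm_one, norm_pow, one_div]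
    refine inv_anti₀ (by positivity) (pow_le_pow_left₀ (by positivity) ?_ 2)
    exact (le_of_lt hz).trans (im_le_norm_sub_ofReal z x)
  · have hz' : 0 < z.im := (half_pos hz₀).trans hz
    exact ((hasDerivAt_id z).sub_const (x : ℂ)).fun_inv (sub_ofReal_ne_zero hz' x)

/-- The Cauchy transform of a probability measure is asymptotic to `1 / z` nontangentially. -/
theorem tendsto_mul_integral_inv_sub (ν : Measure ℝ) [IsProbabilityMeasure ν] (C : ℝ) :
    Tendsto (fun z : ℂ => z * ∫ x : ℝ, (z - x)⁻¹ ∂ν)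
      (comap norm atTop ⊓ 𝓟 {z : ℂ | 0 < z.im ∧ ‖z‖ ≤ C * z.im}) (𝓝 1) := by
  have hone : (1 : ℂ) = ∫ _ : ℝ, (1 : ℂ) ∂ν := by simp
  rw [hone]
  simp_rw [← integral_const_mul]
  refine tendsto_integral_filter_of_dominated_convergence (fun _ => C)
    (.of_forall fun z => by fun_prop) ?_ (integrable_const _) (.of_forall fun x => ?_)
  · refine eventually_inf_principal.2 (.of_forall fun z hz => .of_forall fun x => ?_)
    rw [norm_mul, norm_inv, ← div_eq_mul_inv]
    have h1 := im_le_norm_sub_ofReal z x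
    rw [div_le_iff₀ (hz.1.trans_le h1)]
    have hC : 0 ≤ C := by
      by_contra! h
      nlinarith [norm_nonneg z, hz.1, hz.2]
    exact hz.2.trans (by gcongr)
  · have hinv : Tendsto (fun z : ℂ => z⁻¹) (comap norm atTop) (𝓝 0) := by
      rw [comap_norm_atTop]
      exact tendsto_inv₀_cobounded
    have h1 : Tendsto (fun z : ℂ => (1 - x * z⁻¹)⁻¹) (comap norm atTop) (𝓝 1) := by
      simpa using ((hinv.const_mul (x : ℂ)).const_sub 1).inv₀ (by simp)
    refine (h1.mono_left inf_le_left).congr' ?_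
    refine eventually_inf_principal.2 (.of_forall fun z hz => ?_)
    have hz0 : z ≠ 0 := by
      rintro rfl
      simp at hz
    have : 1 - (x : ℂ) * z⁻¹ = (z - x) * z⁻¹ := by field_simp
    simp only [this, mul_inv, inv_inv, mul_comm]

theorem tendsto_ofReal_mul_I_nontangential {C : ℝ} (hC : 1 ≤ C) :
    Tendsto (fun y : ℝ => (y : ℂ) * I) atTop
      (comap norm atTop ⊓ 𝓟 {z : ℂ | 0 < z.im ∧ ‖z‖ ≤ C * z.im}) := by
  refine tendsto_inf.2 ⟨tendsto_comap_iff.2 ?_, tendsto_principal.2 ?_⟩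
  · simpa [Function.comp_def] using tendsto_abs_atTop_atTop
  · filter_upwards [eventually_gt_atTop 0] with y hy
    simp only [norm_mul, norm_I, norm_real, im_ofReal_mul, I_im,
      mul_one, Real.norm_of_nonneg hy.le]
    exact ⟨hy, by nlinarith⟩

/-- The imaginary part of the inverse Cayley transform. -/
theorem im_inverse_cayley {w : ℂ} (hw : w ≠ 1) :
    (I * (1 + w) / (1 - w)).im = (1 - ‖w‖ ^ 2) / ‖1 - w‖ ^ 2 := by
  have h1 : ‖1 - w‖ ≠ 0 := norm_ne_zero_iff.2 (sub_ne_zero.2 hw.symm)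
  rw [div_im, normSq_eq_norm_sq]
  field_simp
  rw [← normSq_eq_norm_sq, normSq_apply]
  simp
  ring

theorem one_sub_norm_cayley_sq {z : ℂ} (hz : z + I ≠ 0) :
    1 - ‖(z - I) / (z + I)‖ ^ 2 = 4 * z.im / ‖z + I‖ ^ 2 := by
  have h1 : ‖z + I‖ ≠ 0 := norm_ne_zero_iff.2 hz
  rw [norm_div]
  field_simp
  rw [← normSq_eq_norm_sq, ← normSq_eq_norm_sq, normSq_apply, normSq_apply]
  simp
  ring

theorem add_I_ne_zero {z : ℂ} (hz : 0 < z.im) : z + I ≠ 0 := fun h0 => by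
  have := congrArg Complex.im h0
  simp only [add_im, I_im, zero_im] at this
  linarith

/-- The Poisson kernel of the disc in half-plane coordinates, at a finite boundary point. -/
theorem poissonKernel_cayley {z : ℂ} (hz : 0 < z.im) {ζ : ℂ} (hζ : ‖ζ‖ = 1) (hζ1 : ζ ≠ 1) :
    poissonKernel 0 ((z - I) / (z + I)) ζ =
      z.im * (1 + (I * (1 + ζ) / (1 - ζ)).re ^ 2) /
        ‖z - ((I * (1 + ζ) / (1 - ζ)).re : ℝ)‖ ^ 2 := by
  have hzI := add_I_ne_zero hz
  set x : ℝ := (I * (1 + ζ) / (1 - ζ)).re with hx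
  have hxe : I * (1 + ζ) / (1 - ζ) = x := by
    apply Complex.ext
    · simp [hx]
    · rw [im_inverse_cayley hζ1, hζ]
      simp
  have hxI : (x : ℂ) + I ≠ 0 := fun h0 => by simpa using congrArg Complex.im h0
  rw [div_eq_iff (sub_ne_zero.2 hζ1.symm)] at hxe
  have hζx : ζ = (x - I) / (x + I) := by
    rw [eq_div_iff hxI]
    linear_combination hxe
  have hdiff : ζ - (z - I) / (z + I) = -(2 * I * (z - x)) / ((x + I) * (z + I)) := by
    rw [hζx]
    field_simp
    ring
  have hnx : ‖(x : ℂ) + I‖ ^ 2 = 1 + x ^ 2 := by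
    rw [← normSq_eq_norm_sq, normSq_apply]
    simp
    ring
  have h1 : ‖z + I‖ ≠ 0 := norm_ne_zero_iff.2 hzI
  have h2 : ‖z - x‖ ≠ 0 := norm_ne_zero_iff.2 (sub_ofReal_ne_zero hz x)
  rw [poissonKernel_def, sub_zero, sub_zero, hζ, one_pow, one_sub_norm_cayley_sq hzI, hdiff,
    ← hnx]
  have h3 : ‖(x : ℂ) + I‖ ≠ 0 := norm_ne_zero_iff.2 hxI
  simp only [norm_div, norm_neg, norm_mul, norm_I, Complex.norm_ofNat]
  field_simp
  ring

/-- The Poisson kernel of the disc in half-plane coordinates, at the boundary point `∞`. -/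
theorem poissonKernel_cayley_one {z : ℂ} (hz : 0 < z.im) :
    poissonKernel 0 ((z - I) / (z + I)) 1 = z.im := by
  have hzI := add_I_ne_zero hz
  have h1 : ‖z + I‖ ≠ 0 := norm_ne_zero_iff.2 hzI
  have hdiff : 1 - (z - I) / (z + I) = 2 * I / (z + I) := by
    field_simp
    ring
  rw [poissonKernel_def, sub_zero, sub_zero, norm_one, one_pow, one_sub_norm_cayley_sq hzI, hdiff]
  simp only [norm_div, norm_mul, norm_I, Complex.norm_ofNat]
  field_simp
  norm_num

/-- **Nevanlinna representation** of the imaginary part of a holomorphic function mapping the upper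
half-plane to its closure. -/
theorem exists_measure_im_eq_add_integral {h : ℂ → ℂ}
    (hh : DifferentiableOn ℂ h {z : ℂ | 0 < z.im}) (hpos : ∀ z : ℂ, 0 < z.im → 0 ≤ (h z).im) :
    ∃ (a : ℝ) (τ : Measure ℝ), 0 ≤ a ∧ IsFiniteMeasure τ ∧ ∀ z : ℂ, 0 < z.im →
      (h z).im = a * z.im + ∫ x : ℝ, z.im * (1 + x ^ 2) / ‖z - x‖ ^ 2 ∂τ := by
  have hne1 : ∀ w ∈ ball (0 : ℂ) 1, w ≠ 1 := by
    rintro w hw rfl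
    simp at hw
  have hne : ∀ w ∈ ball (0 : ℂ) 1, 1 - w ≠ 0 := fun w hw => sub_ne_zero.2 (hne1 w hw).symm
  have hmaps : MapsTo (fun w : ℂ => I * (1 + w) / (1 - w)) (ball 0 1) {z : ℂ | 0 < z.im} := by
    intro w hw
    have h1 : 0 < ‖1 - w‖ := norm_pos_iff.2 (hne w hw)
    have h2 : ‖w‖ < 1 := mem_ball_zero_iff.1 hw
    simp only [mem_ofPred_eq, im_inverse_cayley (hne1 w hw)]
    exact div_pos (by nlinarith [norm_nonneg w]) (by positivity)
  obtain ⟨σ, hσ, hrep⟩ := exists_measure_re_eq_integral_poissonKernel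
    (p := fun w => -I * h (I * (1 + w) / (1 - w)))
    ((hh.comp (by fun_prop (disch := assumption)) hmaps).const_mul _)
    (fun w hw => by simpa using hpos _ (hmaps hw))
  set A : Set ℝ := {θ | circleMap 0 1 θ = 1} with hA
  have hAm : MeasurableSet A := (isClosed_eq (by fun_prop) (by fun_prop)).measurableSet
  set φ : ℝ → ℝ := fun θ => (I * (1 + circleMap 0 1 θ) / (1 - circleMap 0 1 θ)).re
  have hφm : Measurable φ := by fun_prop
  refine ⟨σ.real A, (σ.restrict Aᶜ).map φ, measureReal_nonneg, inferInstance, fun z hz => ?_⟩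
  have hzI := add_I_ne_zero hz
  have hw : (z - I) / (z + I) ∈ ball (0 : ℂ) 1 := by
    have h1 := one_sub_norm_cayley_sq hzI
    have h2 : 0 < 4 * z.im / ‖z + I‖ ^ 2 := by
      have := norm_pos_iff.2 hzI
      positivity
    rw [mem_ball_zero_iff, ← sq_lt_one_iff₀ (norm_nonneg _)]
    linarith
  have hcay : I * (1 + (z - I) / (z + I)) / (1 - (z - I) / (z + I)) = z := by
    have h2 : 1 - (z - I) / (z + I) = 2 * I / (z + I) := by field_simp; ring
    rw [h2]
    field_simp
    ring
  have h1 := hrep _ hw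
  rw [hcay] at h1
  have hint : Integrable (fun θ => poissonKernel 0 ((z - I) / (z + I)) (circleMap 0 1 θ)) σ := by
    obtain ⟨C, hC⟩ := exists_norm_poissonKernel_circleMap_le hw
    exact Integrable.of_bound (continuous_poissonKernel_circleMap hw).aestronglyMeasurable C
      (.of_forall hC)
  have h2 : (h z).im = (-I * h z).re := by simp
  rw [h2, h1, ← integral_add_compl hAm hint]
  congr 1
  · rw [setIntegral_congr_fun (g := fun _ => z.im) hAm]
    · simp
    · intro θ hθ
      simp only [hA, mem_ofPred_eq] at hθ
      simp only [hθ, poissonKernel_cayley_one hz]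
  · rw [integral_map hφm.aemeasurable]
    · refine setIntegral_congr_fun hAm.compl fun θ hθ => ?_
      exact poissonKernel_cayley hz (by simp) hθ
    · exact Measurable.aestronglyMeasurable (by fun_prop)

/-- A holomorphic map from the upper half-plane to the closed lower half-plane which is asymptotic
to `1 / z` along the imaginary axis is the Cauchy transform of a probability measure. -/
theorem exists_isProbabilityMeasure_eq_integral_inv_sub {G : ℂ → ℂ}
    (hG : DifferentiableOn ℂ G {z : ℂ | 0 < z.im}) (hneg : ∀ z : ℂ, 0 < z.im → (G z).im ≤ 0)
    (hlim : Tendsto (fun y : ℝ => (y * I : ℂ) * G (y * I)) atTop (𝓝 1)) :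
    ∃ ν : Measure ℝ, IsProbabilityMeasure ν ∧
      ∀ z : ℂ, 0 < z.im → G z = ∫ x : ℝ, (z - x)⁻¹ ∂ν := by
  obtain ⟨a, τ, ha, hτ, hrep⟩ := exists_measure_im_eq_add_integral hG.neg
    (fun z hz => by simpa using hneg z hz)
  set k : ℝ → ℝ → ℝ := fun y x => y ^ 2 * (1 + x ^ 2) / (x ^ 2 + y ^ 2) with hk
  have hnorm : ∀ y x : ℝ, ‖(y * I : ℂ) - x‖ ^ 2 = x ^ 2 + y ^ 2 := by
    intro y x
    rw [← normSq_eq_norm_sq, normSq_apply]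
    simp
    ring
  have hrepy : ∀ y : ℝ, 0 < y → ((y * I : ℂ) * G (y * I)).re = a * y ^ 2 + ∫ x, k y x ∂τ := by
    intro y hy
    have h1 := hrep (y * I) (by simpa using hy)
    simp only [hnorm, Pi.neg_apply, neg_im, im_ofReal_mul, I_im, mul_one] at h1
    have h2 : ((y * I : ℂ) * G (y * I)).re = y * -(G (y * I)).im := by simp
    rw [h2, h1, mul_add, ← integral_const_mul]
    congr 1
    · ring
    · refine integral_congr_ae (.of_forall fun x => ?_)
      simp only [hk]
      ring
  have hk0 : ∀ y x, 0 ≤ k y x := fun y x => by positivity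
  have hre : Tendsto (fun y : ℝ => ((y * I : ℂ) * G (y * I)).re) atTop (𝓝 1) :=
    (Complex.continuous_re.tendsto 1).comp hlim
  have ha0 : a = 0 := by
    by_contra hne
    have hapos : 0 < a := lt_of_le_of_ne ha (Ne.symm hne)
    have hinf : Tendsto (fun y : ℝ => ((y * I : ℂ) * G (y * I)).re) atTop atTop := by
      refine tendsto_atTop_mono' _ ?_
        ((tendsto_pow_atTop (α := ℝ) two_ne_zero).const_mul_atTop hapos)
      filter_upwards [eventually_gt_atTop 0] with y hy
      rw [hrepy y hy]
      have : 0 ≤ ∫ x, k y x ∂τ := integral_nonneg (hk0 y)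
      linarith
    exact not_tendsto_nhds_of_tendsto_atTop hinf 1 hre
  subst ha0
  have hkbound : ∀ y x : ℝ, 0 < y → k y x ≤ y ^ 2 + 1 := by
    intro y x hy
    simp only [hk]
    rw [div_le_iff₀ (by positivity)]
    nlinarith [sq_nonneg x, sq_nonneg (y ^ 2)]
  have hki : ∀ y, 0 < y → Integrable (k y) τ := fun y hy =>
    Integrable.of_bound (Measurable.aestronglyMeasurable (by fun_prop)) (y ^ 2 + 1)
      (.of_forall fun x => by
        rw [Real.norm_of_nonneg (hk0 y x)]
        exact hkbound y x hy)
  have hmono : ∀ x, Monotone fun n : ℕ => k n x := by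
    intro x m n hmn
    have hmn' : (m : ℝ) ≤ n := by exact_mod_cast hmn
    rcases Nat.eq_zero_or_pos m with rfl | hm
    · simpa [hk] using hk0 n x
    have hm' : (0 : ℝ) < m := by exact_mod_cast hm
    have hn' : (0 : ℝ) < n := hm'.trans_le hmn'
    simp only [hk]
    rw [div_le_div_iff₀ (by positivity) (by positivity)]
    have : (m : ℝ) ^ 2 ≤ n ^ 2 := by gcongr
    have h3 : 0 ≤ (1 + x ^ 2) * x ^ 2 := by positivity
    nlinarith
  have hptw : ∀ x, Tendsto (fun n : ℕ => k n x) atTop (𝓝 (1 + x ^ 2)) := by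
    intro x
    have h1 : Tendsto (fun n : ℕ => (1 + x ^ 2) / (x ^ 2 * ((n : ℝ)⁻¹) ^ 2 + 1)) atTop
        (𝓝 ((1 + x ^ 2) / (x ^ 2 * 0 ^ 2 + 1))) :=
      tendsto_const_nhds.div
        (((tendsto_inv_atTop_nhds_zero_nat (𝕜 := ℝ)).pow 2 |>.const_mul _).add_const 1) (by simp)
    simp only [ne_eq, OfNat.ofNat_ne_zero, not_false_eq_true, zero_pow, mul_zero, zero_add,
      div_one] at h1
    refine h1.congr' ?_
    filter_upwards [eventually_gt_atTop 0] with n hn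
    have : (0 : ℝ) < n := by exact_mod_cast hn
    simp only [hk]
    field_simp
  set ν : Measure ℝ := τ.withDensity fun x => ENNReal.ofReal (1 + x ^ 2) with hν
  have hmass : ν univ = 1 := by
    rw [hν, withDensity_apply _ MeasurableSet.univ, setLIntegral_univ]
    have h1 := lintegral_tendsto_of_tendsto_of_monotone (μ := τ)
      (f := fun (n : ℕ) x => ENNReal.ofReal (k n x)) (F := fun x => ENNReal.ofReal (1 + x ^ 2))
      (fun n => by fun_prop)
      (.of_forall fun x m n hmn => ENNReal.ofReal_le_ofReal (hmono x hmn))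
      (.of_forall fun x => (ENNReal.continuous_ofReal.tendsto _).comp (hptw x))
    refine tendsto_nhds_unique h1 ?_
    have h2 := (ENNReal.continuous_ofReal.tendsto 1).comp (hre.comp tendsto_natCast_atTop_atTop)
    rw [ENNReal.ofReal_one] at h2
    refine h2.congr' ?_
    filter_upwards [eventually_gt_atTop 0] with n hn
    have hn' : (0 : ℝ) < n := by exact_mod_cast hn
    simp only [Function.comp_apply]
    rw [hrepy n hn', zero_mul, zero_add,
      ofReal_integral_eq_lintegral_ofReal (hki n hn') (.of_forall (hk0 n))]
  have hprob : IsProbabilityMeasure ν := ⟨hmass⟩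
  refine ⟨ν, hprob, ?_⟩
  have him : ∀ z : ℂ, 0 < z.im → (∫ x : ℝ, (z - x)⁻¹ ∂ν).im = (G z).im := by
    intro z hz
    have h1 := hrep z hz
    simp only [Pi.neg_apply, neg_im, zero_mul, zero_add] at h1
    have h2 : (∫ x : ℝ, (z - x)⁻¹ ∂ν).im = ∫ x : ℝ, ((z - x)⁻¹).im ∂ν :=
      (Complex.imCLM.integral_comp_comm (integrable_inv_sub_ofReal ν hz)).symm
    rw [h2, ← neg_neg (G z).im, h1, hν,
      integral_withDensity_eq_integral_toReal_smul (by fun_prop) (by simp), ← integral_neg]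
    refine integral_congr_ae (.of_forall fun x => ?_)
    simp only [ENNReal.toReal_ofReal (show (0 : ℝ) ≤ 1 + x ^ 2 by positivity), inv_im,
      normSq_eq_norm_sq, sub_im, ofReal_im, sub_zero, smul_eq_mul]
    ring
  set D : ℂ → ℂ := fun z => G z - ∫ x : ℝ, (z - x)⁻¹ ∂ν with hD
  have hDan : AnalyticOnNhd ℂ D {z : ℂ | 0 < z.im} :=
    (hG.sub (differentiableOn_integral_inv_sub ν)).analyticOnNhd isOpen_setOf_im_pos
  obtain ⟨c, hc⟩ : ∃ c, ∀ z : ℂ, 0 < z.im → D z = c := by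
    obtain ⟨c, hc⟩ := hDan.eq_const_of_im_eq_const (c₀ := 0) (fun z hz => by
      simp [hD, him z hz]) isOpen_setOf_im_pos
      ((convex_halfSpace_im_gt 0).isConnected ⟨I, by simp⟩)
    exact ⟨c, fun z hz => hc z hz⟩
  have hlimD : Tendsto (fun y : ℝ => (y * I : ℂ) * D (y * I)) atTop (𝓝 0) := by
    have h1 := (tendsto_mul_integral_inv_sub ν 1).comp (tendsto_ofReal_mul_I_nontangential le_rfl)
    simpa [hD, mul_sub, Function.comp_def] using hlim.sub h1
  have hc0 : c = 0 := by
    have h1 : Tendsto (fun y : ℝ => y * ‖c‖) atTop (𝓝 0) := by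
      refine (tendsto_zero_iff_norm_tendsto_zero.1 hlimD).congr' ?_
      filter_upwards [eventually_gt_atTop 0] with y hy
      rw [hc _ (by simpa using hy)]
      simp [abs_of_pos hy]
    by_contra hne
    exact not_tendsto_nhds_of_tendsto_atTop
      (tendsto_id.atTop_mul_const (norm_pos_iff.2 hne)) 0 h1
  intro z hz
  exact sub_eq_zero.1 ((hc z hz).trans hc0)

/-- The F-transform of a probability measure is nontangentially asymptotic to the identity. -/
theorem exists_forall_norm_fTransform_sub_le (ν : Measure ℝ) [IsProbabilityMeasure ν] (C : ℝ)
    {δ : ℝ} (hδ : 0 < δ) :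
    ∃ R : ℝ, ∀ z : ℂ, R ≤ ‖z‖ → 0 < z.im → ‖z‖ ≤ C * z.im →
      ‖(∫ x : ℝ, (z - x)⁻¹ ∂ν)⁻¹ - z‖ ≤ δ * ‖z‖ := by
  have h1 := (tendsto_mul_integral_inv_sub ν C).inv₀ one_ne_zero
  rw [inv_one] at h1
  have h2 := eventually_inf_principal.1 (Metric.tendsto_nhds.1 h1 δ hδ)
  obtain ⟨R, hR⟩ := eventually_atTop.1 (eventually_comap.1 h2)
  refine ⟨R, fun z hRz hz hzC => ?_⟩
  have h3 := hR ‖z‖ hRz z rfl ⟨hz, hzC⟩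
  have hz0 : z ≠ 0 := by
    rintro rfl
    simp at hz
  rw [dist_eq_norm] at h3
  have h4 : (∫ x : ℝ, (z - x)⁻¹ ∂ν)⁻¹ - z = ((z * ∫ x : ℝ, (z - x)⁻¹ ∂ν)⁻¹ - 1) * z := by
    rw [mul_inv]
    field_simp
  rw [h4, norm_mul]
  gcongr

/-- If `F ∘ g = H` where `F` and `H` are F-transforms of probability measures and `F` is univalent,
then `g` is asymptotic to the identity along the imaginary axis. -/
theorem tendsto_div_of_comp_eq_fTransform {F g : ℂ → ℂ} (μ ν : Measure ℝ)
    [IsProbabilityMeasure μ] [IsProbabilityMeasure ν]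
    (hF : DifferentiableOn ℂ F {z : ℂ | 0 < z.im}) (hinj : InjOn F {z : ℂ | 0 < z.im})
    (hFμ : ∀ z : ℂ, 0 < z.im → F z = (∫ x : ℝ, (z - x)⁻¹ ∂μ)⁻¹)
    (hg : MapsTo g {z : ℂ | 0 < z.im} {z : ℂ | 0 < z.im})
    (hcomp : ∀ z : ℂ, 0 < z.im → F (g z) = (∫ x : ℝ, (z - x)⁻¹ ∂ν)⁻¹) :
    Tendsto (fun y : ℝ => g (y * I) / (y * I)) atTop (𝓝 1) := by
  refine Metric.tendsto_nhds.2 fun ε hε => ?_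
  set δ : ℝ := min (1 / 16) (ε / 3)
  have hδ : 0 < δ := by positivity
  have hδ1 : δ ≤ 1 / 16 := min_le_left _ _
  have hδ2 : δ ≤ ε / 3 := min_le_right _ _
  obtain ⟨R₁, hR₁⟩ := exists_forall_norm_fTransform_sub_le μ 3 hδ
  obtain ⟨R₂, hR₂⟩ := exists_forall_norm_fTransform_sub_le ν 3 hδ
  filter_upwards [eventually_gt_atTop 0, eventually_ge_atTop (2 * R₁), eventually_ge_atTop R₂]
    with y hy hyR₁ hyR₂
  set z₀ : ℂ := y * I with hz₀
  have hz₀im : z₀.im = y := by simp [hz₀]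
  have hz₀norm : ‖z₀‖ = y := by simp [hz₀, abs_of_pos hy]
  have hball : ∀ z ∈ closedBall z₀ (y / 2), 0 < z.im ∧ ‖F z - z‖ ≤ δ * (3 / 2 * y) := by
    intro z hz
    rw [mem_closedBall, dist_eq_norm] at hz
    have h1 : y / 2 ≤ z.im := by
      have h2 := (Complex.abs_im_le_norm (z - z₀)).trans hz
      rw [sub_im, hz₀im, abs_le] at h2
      linarith
    have h3 : ‖z‖ ≤ 3 / 2 * y := by
      have := norm_le_norm_add_norm_sub' z z₀
      linarith
    have h4 : z.im ≤ ‖z‖ := Complex.im_le_norm z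
    have hzpos : 0 < z.im := by linarith
    refine ⟨hzpos, ?_⟩
    rw [hFμ z hzpos]
    refine (hR₁ z (by linarith) hzpos (by linarith)).trans ?_
    gcongr
  have hH : ‖F (g z₀) - z₀‖ ≤ δ * y := by
    rw [hcomp z₀ (by rwa [hz₀im]), ← hz₀norm]
    exact hR₂ z₀ (by linarith) (by linarith) (by linarith)
  have hF0 : ‖F z₀ - z₀‖ ≤ δ * y := by
    rw [hFμ z₀ (by rwa [hz₀im]), ← hz₀norm]
    exact hR₁ z₀ (by linarith) (by linarith) (by linarith)
  have hsub : ball (F z₀) ((y / 2 - 5 / 2 * δ * y) / 2) ⊆ F '' closedBall z₀ (y / 2) := by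
    refine DiffContOnCl.ball_subset_image_closedBall
      (DifferentiableOn.diffContOnCl (hF.mono ?_)) (by positivity) (fun z hz => ?_) ?_
    · exact closure_ball_subset_closedBall.trans fun z hz => (hball z hz).1
    · have h1 := (hball z (sphere_subset_closedBall hz)).2
      rw [mem_sphere, dist_eq_norm] at hz
      have h2 : ‖z - z₀‖ ≤ ‖F z - z‖ + ‖F z - F z₀‖ + ‖F z₀ - z₀‖ := by
        have h3 : z - z₀ = -(F z - z) + (F z - F z₀) + (F z₀ - z₀) := by ring
        rw [h3]
        refine (norm_add₃_le).trans ?_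
        rw [norm_neg]
      linarith
    · have hev : ∀ᶠ z in 𝓝[≠] z₀, F z ≠ F z₀ := by
        filter_upwards [nhdsWithin_le_nhds (isOpen_setOf_im_pos.mem_nhds
          (show z₀ ∈ {z : ℂ | 0 < z.im} by simpa [hz₀im] using hy)), self_mem_nhdsWithin]
          with z hz hne heq
        exact hne (hinj hz (by simpa [hz₀im] using hy) heq)
      exact hev.frequently.filter_mono nhdsWithin_le_nhds
  obtain ⟨w, hw, hFw⟩ : F (g z₀) ∈ F '' closedBall z₀ (y / 2) := by
    refine hsub ?_
    rw [mem_ball, dist_eq_norm]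
    have h1 : ‖F (g z₀) - F z₀‖ ≤ ‖F (g z₀) - z₀‖ + ‖F z₀ - z₀‖ := by
      have h2 : F (g z₀) - F z₀ = (F (g z₀) - z₀) - (F z₀ - z₀) := by ring
      rw [h2]
      exact norm_sub_le _ _
    nlinarith
  obtain rfl : w = g z₀ := hinj (hball w hw).1 (hg (by simpa [hz₀im] using hy)) hFw
  have h1 := (hball _ hw).2
  have h2 : ‖g z₀ - z₀‖ ≤ ‖F (g z₀) - z₀‖ + ‖F (g z₀) - g z₀‖ := by
    have h3 : g z₀ - z₀ = (F (g z₀) - z₀) - (F (g z₀) - g z₀) := by ring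
    rw [h3]
    exact norm_sub_le _ _
  have hz₀ne : z₀ ≠ 0 := norm_pos_iff.1 (by rwa [hz₀norm])
  rw [dist_eq_norm, div_sub_one hz₀ne, norm_div, hz₀norm, div_lt_iff₀ hy]
  nlinarith

end

/-- If `(f_t)` is a decreasing family of univalent holomorphic self-maps of
the upper half-plane `ℍ` with `f_0 = id`, each `f_t` being the F-transform of
a probability measure `μ_{0,t}`, then for `0 ≤ s ≤ t` the transition map
`f_{s,t} = f_s⁻¹ ∘ f_t` is a well-defined holomorphic self-map of `ℍ` which is
the F-transform of a probability measure `μ_{s,t}`, and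
`μ_{0,t} = μ_{0,s} ▷ μ_{s,t}`, i.e. `F_{μ_{0,t}} = F_{μ_{0,s}} ∘ F_{μ_{s,t}}`. -/
theorem transition_maps_monotone_convolution
    (f : ℝ → ℂ → ℂ) (μ : ℝ → Measure ℝ) [∀ t, IsProbabilityMeasure (μ t)]
    (hid : ∀ z : ℂ, 0 < z.im → f 0 z = z)
    (hmaps : ∀ t : ℝ, 0 ≤ t → Set.MapsTo (f t) {z : ℂ | 0 < z.im} {z : ℂ | 0 < z.im})
    (hholo : ∀ t : ℝ, 0 ≤ t → DifferentiableOn ℂ (f t) {z : ℂ | 0 < z.im})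
    (hinj : ∀ t : ℝ, 0 ≤ t → Set.InjOn (f t) {z : ℂ | 0 < z.im})
    (hdecr : ∀ s t : ℝ, 0 ≤ s → s ≤ t →
      f t '' {z : ℂ | 0 < z.im} ⊆ f s '' {z : ℂ | 0 < z.im})
    (hFtrans : ∀ t : ℝ, 0 ≤ t → ∀ z : ℂ, 0 < z.im →
      f t z = (∫ x : ℝ, (z - x)⁻¹ ∂(μ t))⁻¹) :
    ∀ s t : ℝ, 0 ≤ s → s ≤ t →
      ∃ (g : ℂ → ℂ) (ν : Measure ℝ), IsProbabilityMeasure ν ∧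
        Set.MapsTo g {z : ℂ | 0 < z.im} {z : ℂ | 0 < z.im} ∧
        DifferentiableOn ℂ g {z : ℂ | 0 < z.im} ∧
        (∀ z : ℂ, 0 < z.im → g z = (∫ x : ℝ, (z - x)⁻¹ ∂ν)⁻¹) ∧
        (∀ z : ℂ, 0 < z.im → f t z = f s (g z)) := by
  intro s t hs hst
  have ht : 0 ≤ t := hs.trans hst
  set g : ℂ → ℂ := Function.invFunOn (f s) {z : ℂ | 0 < z.im} ∘ f t
  have hmem : ∀ z : ℂ, 0 < z.im → f t z ∈ f s '' {z : ℂ | 0 < z.im} := fun z hz =>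
    hdecr s t hs hst ⟨z, hz, rfl⟩
  have hgmaps : Set.MapsTo g {z : ℂ | 0 < z.im} {z : ℂ | 0 < z.im} := fun z hz =>
    Function.invFunOn_mem (hmem z hz)
  have hcomp : ∀ z : ℂ, 0 < z.im → f s (g z) = f t z := fun z hz =>
    Function.invFunOn_eq (hmem z hz)
  have hgd : DifferentiableOn ℂ g {z : ℂ | 0 < z.im} := by
    intro z hz
    have h1 := differentiableAt_invFunOn_of_injOn isOpen_setOf_im_pos (hholo s hs) (hinj s hs)
      (hgmaps hz)
    rw [hcomp z hz] at h1
    exact h1.comp_differentiableWithinAt z (hholo t ht z hz)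
  have hg0 : ∀ z : ℂ, 0 < z.im → g z ≠ 0 := fun z hz h0 => by
    have h1 : 0 < (g z).im := hgmaps hz
    simp [h0] at h1
  have hlim := tendsto_div_of_comp_eq_fTransform (μ s) (μ t) (hholo s hs) (hinj s hs)
    (hFtrans s hs) hgmaps (fun z hz => (hcomp z hz).trans (hFtrans t ht z hz))
  obtain ⟨ν, hν, hGν⟩ := exists_isProbabilityMeasure_eq_integral_inv_sub (G := fun z => (g z)⁻¹)
    (hgd.fun_inv hg0)
    (fun z hz => by
      have h1 : 0 < (g z).im := hgmaps hz
      rw [inv_im, neg_div, neg_nonpos]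
      exact div_nonneg h1.le (normSq_nonneg _))
    (by simpa [div_eq_mul_inv, mul_comm] using hlim.inv₀ one_ne_zero)
  exact ⟨g, ν, hν, hgmaps, hgd, fun z hz => by rw [← hGν z hz, inv_inv],
    fun z hz => (hcomp z hz).symm⟩
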